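/- Let {w^j}_{j≥0} ⊆ C be a sequence generated by SCA with backtracking line search: for each j, s^j is a subgradient of the largest-k norm at w^j; H^j ∈ ℝ^{N×N} is symmetric positive semidefinite with ‖H^j‖ ≤ B for a fixed B; ŵ^{j+1} minimizes over C the objective F_j(w) = f_cvx(w) + ρ‖w‖₁ + f_ncvx(w^j) + ∇f_ncvx(w^j)ᵀ(w − w^j) + (1/2)(w − w^j)ᵀ H^j (w − w^j) + (τ_w/2)‖w − w^j‖² − ρ (s^j)ᵀ w; and w^{j+1} = w^j + γ^j (ŵ^{j+1} − w^j), where γ^j = β^{m_j} with m_j the smallest nonnegative integer m such that, with d^j = ŵ^{j+1} − w^j and Δ_j = (d^j)ᵀ(∇f(w^j) − ρ s^j) + ρ(‖ŵ^{j+1}‖₁ − ‖w^j‖₁), one has f(w^j + β^m d^j) − β^m ρ (d^j)ᵀ s^j + β^m ρ (‖ŵ^{j+1}‖₁ − ‖w^j‖₁) ≤ f(w^j) + c β^m Δ_j. Then every limit point w̄ of {w^j} is a stationary point of the penalized problem: there exists a subgradient s̄ of the largest-k norm at w̄ such that (w − w̄)ᵀ(∇f(w̄) − ρ s̄) + ρ(‖w‖₁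 − ‖w̄‖₁) ≥ 0 for all w ∈ C. -/

import Mathlib

open Matrix Finset Filter Topology

noncomputable section

/-- Kronecker product `w ⊗ w` of a vector with itself, viewed as a vector in `ℝ^{N²}`. -/
def kron2 {N : ℕ} (w : Fin N → ℝ) : Fin N × Fin N → ℝ := fun p => w p.1 * w p.2

/-- Kronecker product `w ⊗ w ⊗ w`, viewed as a vector in `ℝ^{N³}`. -/
def kron3 {N : ℕ} (w : Fin N → ℝ) : Fin N × Fin N × Fin N → ℝ :=
  fun p => w p.1 * w p.2.1 * w p.2.2

/-- Sample covariance matrix `Σ = (1/T) ∑ₜ rₜ rₜᵀ`. -/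
def covar {N T : ℕ} (r : Fin T → Fin N → ℝ) : Matrix (Fin N) (Fin N) ℝ :=
  (1 / (T : ℝ)) • ∑ t, vecMulVec (r t) (r t)

/-- Co-skewness matrix `Φ = (1/T) ∑ₜ rₜ (rₜᵀ ⊗ rₜᵀ) ∈ ℝ^{N×N²}`. -/
def coskew {N T : ℕ} (r : Fin T → Fin N → ℝ) : Matrix (Fin N) (Fin N × Fin N) ℝ :=
  (1 / (T : ℝ)) • ∑ t, vecMulVec (r t) (kron2 (r t))

/-- Co-kurtosis matrix `Ψ = (1/T) ∑ₜ rₜ (rₜᵀ ⊗ rₜᵀ ⊗ rₜᵀ) ∈ ℝ^{N×N³}`. -/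
def cokurt {N T : ℕ} (r : Fin T → Fin N → ℝ) : Matrix (Fin N) (Fin N × Fin N × Fin N) ℝ :=
  (1 / (T : ℝ)) • ∑ t, vecMulVec (r t) (kron3 (r t))

/-- Third sample central moment `φ₃(w) = (1/T) ∑ₜ (wᵀ rₜ)³`. -/
def phi3 {N T : ℕ} (r : Fin T → Fin N → ℝ) (w : Fin N → ℝ) : ℝ :=
  (1 / (T : ℝ)) * ∑ t, (w ⬝ᵥ r t) ^ 3

/-- Fourth sample central moment `φ₄(w) = (1/T) ∑ₜ (wᵀ rₜ)⁴`. -/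
def phi4 {N T : ℕ} (r : Fin T → Fin N → ℝ) (w : Fin N → ℝ) : ℝ :=
  (1 / (T : ℝ)) * ∑ t, (w ⬝ᵥ r t) ^ 4

/-- The ℓ₁ norm `‖w‖₁ = ∑ᵢ |wᵢ|`. -/
def ell1 {N : ℕ} (w : Fin N → ℝ) : ℝ := ∑ i, |w i|

/-- The largest-`k` norm `‖w‖_[k]`: the maximum of `∑_{i ∈ S} |wᵢ|` over subsets `S` of
cardinality `k` (for `k ≤ N` the set below is a nonempty finite set of reals, so its
supremum is this maximum). -/
def topk {N : ℕ} (k : ℕ) (w : Fin N → ℝ) : ℝ :=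
  sSup {x : ℝ | ∃ S : Finset (Fin N), S.card = k ∧ x = ∑ i ∈ S, |w i|}

/-- `s` is a subgradient of the largest-`k` norm at `w`. -/
def IsSubgradTopk {N : ℕ} (k : ℕ) (w s : Fin N → ℝ) : Prop :=
  ∀ v : Fin N → ℝ, topk k w + s ⬝ᵥ (v - w) ≤ topk k v

/-- Feasible set `C = {w : 1ᵀ w = 1, |wᵢ| ≤ α ∀i}`. -/
def Feas (N : ℕ) (α : ℝ) : Set (Fin N → ℝ) :=
  {w | ∑ i, w i = 1 ∧ ∀ i, |w i| ≤ α}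

/-- Maximum absolute row sum `max_{1≤i≤N} ∑ⱼ |A_{ij}|` (as the supremum of a nonempty
finite set of reals when `N ≥ 1`). -/
def maxRowSum {N : ℕ} {J : Type} [Fintype J] (A : Matrix (Fin N) J ℝ) : ℝ :=
  sSup (Set.range fun i : Fin N => ∑ j, |A i j|)

/-- The DC constant `τ_dc = 6αλ₃ max-row-sum(Φ) + 12α²λ₄ max-row-sum(Ψ)`. -/
def tauDC {N T : ℕ} (α l3 l4 : ℝ) (r : Fin T → Fin N → ℝ) : ℝ :=
  6 * α * l3 * maxRowSum (coskew r) + 12 * α ^ 2 * l4 * maxRowSum (cokurt r)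

/-- Convex part `f_cvx(w) = -λ₁ μᵀw + λ₂ wᵀ Σ w`. -/
def fcvx {N T : ℕ} (l1 l2 : ℝ) (μ : Fin N → ℝ) (r : Fin T → Fin N → ℝ) (w : Fin N → ℝ) : ℝ :=
  -l1 * (μ ⬝ᵥ w) + l2 * (w ⬝ᵥ (covar r).mulVec w)

/-- Non-convex part `f_ncvx(w) = -λ₃ wᵀ Φ (w⊗w) + λ₄ wᵀ Ψ (w⊗w⊗w)`. -/
def fncvx {N T : ℕ} (l3 l4 : ℝ) (r : Fin T → Fin N → ℝ) (w : Fin N → ℝ) : ℝ :=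
  -l3 * (w ⬝ᵥ (coskew r).mulVec (kron2 w)) + l4 * (w ⬝ᵥ (cokurt r).mulVec (kron3 w))

/-- Gradient of the non-convex part: `∇f_ncvx(w) = -3λ₃ Φ(w⊗w) + 4λ₄ Ψ(w⊗w⊗w)`. -/
def gradfncvx {N T : ℕ} (l3 l4 : ℝ) (r : Fin T → Fin N → ℝ) (w : Fin N → ℝ) : Fin N → ℝ :=
  (-(3 * l3)) • (coskew r).mulVec (kron2 w) + (4 * l4) • (cokurt r).mulVec (kron3 w)

/-- Gradient of the MVSK objective `∇f = ∇f_cvx + ∇f_ncvx`. -/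
def gradf {N T : ℕ} (l1 l2 l3 l4 : ℝ) (μ : Fin N → ℝ) (r : Fin T → Fin N → ℝ)
    (w : Fin N → ℝ) : Fin N → ℝ :=
  ((-l1) • μ + (2 * l2) • (covar r).mulVec w) + gradfncvx l3 l4 r w

/-- The MVSK objective `f = f_cvx + f_ncvx`. -/
def ftot {N T : ℕ} (l1 l2 l3 l4 : ℝ) (μ : Fin N → ℝ) (r : Fin T → Fin N → ℝ)
    (w : Fin N → ℝ) : ℝ :=
  fcvx l1 l2 μ r w + fncvx l3 l4 r w

/-- The penalized objective `f_p(w) = f(w) + ρ (‖w‖₁ - ‖w‖_[k])`. -/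
def fpen {N T : ℕ} (l1 l2 l3 l4 ρ : ℝ) (k : ℕ) (μ : Fin N → ℝ) (r : Fin T → Fin N → ℝ)
    (w : Fin N → ℝ) : ℝ :=
  ftot l1 l2 l3 l4 μ r w + ρ * (ell1 w - topk k w)

/-- The Kronecker product `I_N ⊗ w ∈ ℝ^{N²×N}` of the identity matrix with a (column) vector. -/
def kronIdVec {N : ℕ} (w : Fin N → ℝ) : Matrix (Fin N × Fin N) (Fin N) ℝ :=
  Matrix.of fun p j => (1 : Matrix (Fin N) (Fin N) ℝ) p.1 j * w p.2

/-- The Kronecker product `I_N ⊗ w ⊗ w ∈ ℝ^{N³×N}`. -/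
def kronIdVec2 {N : ℕ} (w : Fin N → ℝ) : Matrix (Fin N × Fin N × Fin N) (Fin N) ℝ :=
  Matrix.of fun p j => (1 : Matrix (Fin N) (Fin N) ℝ) p.1 j * w p.2.1 * w p.2.2

/-- The pDCA subproblem objective
`G(w) = f_cvx(w) + (τ_dc/2) wᵀw + ρ‖w‖₁ - (τ_dc wʲ - ∇f_ncvx(wʲ) + ρ sʲ)ᵀ w`. -/
def Gpdca {N T : ℕ} (l1 l2 l3 l4 α ρ : ℝ) (μ : Fin N → ℝ) (r : Fin T → Fin N → ℝ)
    (wj sj w : Fin N → ℝ) : ℝ :=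
  fcvx l1 l2 μ r w + tauDC α l3 l4 r / 2 * (w ⬝ᵥ w) + ρ * ell1 w
    - (tauDC α l3 l4 r • wj - gradfncvx l3 l4 r wj + ρ • sj) ⬝ᵥ w

end
/-- The SCA subproblem objective
`F(w) = f_cvx(w) + ρ‖w‖₁ + f_ncvx(wʲ) + ∇f_ncvx(wʲ)ᵀ(w−wʲ) + ½(w−wʲ)ᵀH(w−wʲ)
        + (τ_w/2)‖w−wʲ‖² − ρ (sʲ)ᵀ w`. -/
noncomputable def Fsca {N T : ℕ} (l1 l2 l3 l4 ρ τw : ℝ) (μ : Fin N → ℝ)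
    (r : Fin T → Fin N → ℝ) (wj sj : Fin N → ℝ) (H : Matrix (Fin N) (Fin N) ℝ)
    (w : Fin N → ℝ) : ℝ :=
  fcvx l1 l2 μ r w + ρ * ell1 w + fncvx l3 l4 r wj + gradfncvx l3 l4 r wj ⬝ᵥ (w - wj)
    + 1 / 2 * ((w - wj) ⬝ᵥ H.mulVec (w - wj)) + τw / 2 * ∑ i, (w i - wj i) ^ 2
    - ρ * (sj ⬝ᵥ w)

/-- The Armijo backtracking condition for SCA at iterate `wj` with direction `d = ŵ − wj`
and stepsize `βᵐ`. -/
noncomputable def Armijo {N T : ℕ} (l1 l2 l3 l4 ρ c β : ℝ) (μ : Fin N → ℝ)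
    (r : Fin T → Fin N → ℝ) (wj sj what : Fin N → ℝ) (m : ℕ) : Prop :=
  ftot l1 l2 l3 l4 μ r (wj + β ^ m • (what - wj)) - β ^ m * ρ * ((what - wj) ⬝ᵥ sj)
      + β ^ m * ρ * (ell1 what - ell1 wj)
    ≤ ftot l1 l2 l3 l4 μ r wj
        + c * β ^ m * ((what - wj) ⬝ᵥ (gradf l1 l2 l3 l4 μ r wj - ρ • sj)
            + ρ * (ell1 what - ell1 wj))

theorem dotProduct_sum_vecMulVec_mulVec {N T : ℕ} {J : Type*} [Fintype J] (a : ℝ)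
    (r : Fin T → Fin N → ℝ) (q : Fin T → J → ℝ) (v : Fin N → ℝ) (x : J → ℝ) :
    v ⬝ᵥ (a • ∑ t, vecMulVec (r t) (q t)).mulVec x
      = a * ∑ t, (v ⬝ᵥ r t) * (q t ⬝ᵥ x) := by
  simp only [smul_mulVec, dotProduct_smul, sum_mulVec, dotProduct_sum, vecMulVec_mulVec,
    smul_eq_mul, op_smul_eq_smul]
  congr 1
  exact Finset.sum_congr rfl fun t _ => mul_comm _ _

theorem kron2_dotProduct_kron2 {N : ℕ} (x w : Fin N → ℝ) :
    kron2 x ⬝ᵥ kron2 w = (w ⬝ᵥ x) ^ 2 := by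
  simp only [dotProduct, kron2, Fintype.sum_prod_type, sq, Finset.sum_mul_sum]
  exact Finset.sum_congr rfl fun i _ => Finset.sum_congr rfl fun j _ => by ring

theorem kron3_dotProduct_kron3 {N : ℕ} (x w : Fin N → ℝ) :
    kron3 x ⬝ᵥ kron3 w = (w ⬝ᵥ x) ^ 3 := by
  rw [pow_succ', ← kron2_dotProduct_kron2]
  simp only [dotProduct, kron3, kron2, Fintype.sum_prod_type (α₁ := Fin N) (α₂ := Fin N × Fin N),
    Finset.sum_mul_sum]
  exact Finset.sum_congr rfl fun i _ => Finset.sum_congr rfl fun j _ => by ring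

theorem dotProduct_covar_mulVec {N T : ℕ} (r : Fin T → Fin N → ℝ) (v w : Fin N → ℝ) :
    v ⬝ᵥ (covar r).mulVec w = 1 / (T : ℝ) * ∑ t, (v ⬝ᵥ r t) * (w ⬝ᵥ r t) := by
  rw [covar, dotProduct_sum_vecMulVec_mulVec]
  simp only [dotProduct_comm w]

theorem dotProduct_coskew_mulVec_kron2 {N T : ℕ} (r : Fin T → Fin N → ℝ) (v w : Fin N → ℝ) :
    v ⬝ᵥ (coskew r).mulVec (kron2 w) = 1 / (T : ℝ) * ∑ t, (v ⬝ᵥ r t) * (w ⬝ᵥ r t) ^ 2 := by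
  rw [coskew, dotProduct_sum_vecMulVec_mulVec]
  simp only [kron2_dotProduct_kron2]

theorem dotProduct_cokurt_mulVec_kron3 {N T : ℕ} (r : Fin T → Fin N → ℝ) (v w : Fin N → ℝ) :
    v ⬝ᵥ (cokurt r).mulVec (kron3 w) = 1 / (T : ℝ) * ∑ t, (v ⬝ᵥ r t) * (w ⬝ᵥ r t) ^ 3 := by
  rw [cokurt, dotProduct_sum_vecMulVec_mulVec]
  simp only [kron3_dotProduct_kron3]

theorem dotProduct_covar_mulVec_self_nonneg {N T : ℕ} (r : Fin T → Fin N → ℝ)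
    (d : Fin N → ℝ) : 0 ≤ d ⬝ᵥ (covar r).mulVec d := by
  rw [dotProduct_covar_mulVec]
  exact mul_nonneg (by positivity) (Finset.sum_nonneg fun t _ => mul_self_nonneg _)

/-- The exact second-order expansion of `fcvx` along a line. -/
theorem fcvx_add_smul {N T : ℕ} (l1 l2 : ℝ) (μ : Fin N → ℝ) (r : Fin T → Fin N → ℝ)
    (w d : Fin N → ℝ) (t : ℝ) :
    fcvx l1 l2 μ r (w + t • d) = fcvx l1 l2 μ r w
      + t * (d ⬝ᵥ ((-l1) • μ + (2 * l2) • (covar r).mulVec w))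
      + t ^ 2 * (l2 * (d ⬝ᵥ (covar r).mulVec d)) := by
  simp only [fcvx, dotProduct_add, dotProduct_smul, smul_eq_mul, add_dotProduct, smul_dotProduct,
    dotProduct_covar_mulVec, dotProduct_comm μ]
  have h (a : Fin N → ℝ) : ∑ i, (a ⬝ᵥ r i) * (w ⬝ᵥ r i + t * (d ⬝ᵥ r i))
      = ∑ i, (a ⬝ᵥ r i) * (w ⬝ᵥ r i) + t * ∑ i, (a ⬝ᵥ r i) * (d ⬝ᵥ r i) := by
    simp only [Finset.mul_sum, ← Finset.sum_add_distrib]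
    exact Finset.sum_congr rfl fun i _ => by ring
  rw [h, h, Finset.sum_congr rfl fun i _ => mul_comm (w ⬝ᵥ r i) (d ⬝ᵥ r i)]
  ring

/-- The coefficient of `t ^ 2` in the expansion of `fncvx (w + t • d)`. -/
noncomputable def fncvxRem {N T : ℕ} (l3 l4 : ℝ) (r : Fin T → Fin N → ℝ) (w d : Fin N → ℝ) (t : ℝ) : ℝ :=
  -l3 * (1 / (T : ℝ) * ∑ i, (3 * (w ⬝ᵥ r i) * (d ⬝ᵥ r i) ^ 2 + t * (d ⬝ᵥ r i) ^ 3))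
    + l4 * (1 / (T : ℝ) * ∑ i, (6 * (w ⬝ᵥ r i) ^ 2 * (d ⬝ᵥ r i) ^ 2
      + 4 * t * (w ⬝ᵥ r i) * (d ⬝ᵥ r i) ^ 3 + t ^ 2 * (d ⬝ᵥ r i) ^ 4))

theorem fncvx_add_smul {N T : ℕ} (l3 l4 : ℝ) (r : Fin T → Fin N → ℝ)
    (w d : Fin N → ℝ) (t : ℝ) :
    fncvx l3 l4 r (w + t • d) = fncvx l3 l4 r w + t * (d ⬝ᵥ gradfncvx l3 l4 r w)
      + t ^ 2 * fncvxRem l3 l4 r w d t := by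
  simp only [fncvx, gradfncvx, fncvxRem, dotProduct_add, dotProduct_smul, smul_eq_mul,
    dotProduct_coskew_mulVec_kron2, dotProduct_cokurt_mulVec_kron3, add_dotProduct,
    smul_dotProduct]
  simp only [Finset.mul_sum, ← Finset.sum_add_distrib]
  exact Finset.sum_congr rfl fun i _ => by ring

theorem ftot_add_smul {N T : ℕ} (l1 l2 l3 l4 : ℝ) (μ : Fin N → ℝ) (r : Fin T → Fin N → ℝ)
    (w d : Fin N → ℝ) (t : ℝ) :
    ftot l1 l2 l3 l4 μ r (w + t • d) = ftot l1 l2 l3 l4 μ r w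
      + t * (d ⬝ᵥ gradf l1 l2 l3 l4 μ r w)
      + t ^ 2 * (l2 * (d ⬝ᵥ (covar r).mulVec d) + fncvxRem l3 l4 r w d t) := by
  rw [ftot, fcvx_add_smul, fncvx_add_smul, ftot, gradf, dotProduct_add d _ (gradfncvx l3 l4 r w)]
  ring

theorem continuous_kron2 {N : ℕ} : Continuous (kron2 (N := N)) := by
  unfold kron2; fun_prop

theorem continuous_kron3 {N : ℕ} : Continuous (kron3 (N := N)) := by
  unfold kron3; fun_prop

theorem continuous_gradfncvx {N T : ℕ} (l3 l4 : ℝ) (r : Fin T → Fin N → ℝ) :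
    Continuous (gradfncvx l3 l4 r) := by
  have h2 := continuous_kron2 (N := N)
  have h3 := continuous_kron3 (N := N)
  unfold gradfncvx
  fun_prop

theorem continuous_ftot {N T : ℕ} (l1 l2 l3 l4 : ℝ) (μ : Fin N → ℝ) (r : Fin T → Fin N → ℝ) :
    Continuous (ftot l1 l2 l3 l4 μ r) := by
  unfold ftot fcvx fncvx
  simp only [dotProduct_covar_mulVec, dotProduct_coskew_mulVec_kron2,
    dotProduct_cokurt_mulVec_kron3]
  simp only [dotProduct]
  fun_prop

theorem continuous_ell1 {N : ℕ} : Continuous (ell1 (N := N)) := by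
  unfold ell1; fun_prop

theorem ell1_add_smul_sub_le {N : ℕ} (w v : Fin N → ℝ) {t : ℝ} (h0 : 0 ≤ t) (h1 : t ≤ 1) :
    ell1 (w + t • (v - w)) ≤ ell1 w + t * (ell1 v - ell1 w) := by
  simp only [ell1, ← Finset.sum_sub_distrib, Finset.mul_sum, ← Finset.sum_add_distrib]
  refine Finset.sum_le_sum fun i _ => ?_
  have h : (w + t • (v - w)) i = (1 - t) * w i + t * v i := by
    simp only [Pi.add_apply, Pi.smul_apply, Pi.sub_apply, smul_eq_mul]; ring
  rw [h]
  refine (abs_add_le _ _).trans_eq ?_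
  rw [abs_mul, abs_mul, abs_of_nonneg h0, abs_of_nonneg (sub_nonneg.2 h1)]
  ring

theorem sum_abs_le_topk {N : ℕ} (w : Fin N → ℝ) (S : Finset (Fin N)) :
    ∑ i ∈ S, |w i| ≤ topk S.card w := by
  refine le_csSup ?_ ⟨S, rfl, rfl⟩
  refine ⟨∑ i, |w i|, ?_⟩
  rintro x ⟨S', -, rfl⟩
  exact Finset.sum_le_univ_sum_of_nonneg fun i => abs_nonneg _

theorem topk_le_add_ell1_sub {N k : ℕ} (hkN : k ≤ N) (w v : Fin N → ℝ) :
    topk k w ≤ topk k v + ell1 (w - v) := by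
  refine csSup_le ?_ ?_
  · obtain ⟨S, -, hS⟩ := Finset.exists_subset_card_eq
      (s := (Finset.univ : Finset (Fin N))) (n := k) (by simpa using hkN)
    exact ⟨_, S, hS, rfl⟩
  · rintro x ⟨S, rfl, rfl⟩
    calc ∑ i ∈ S, |w i| ≤ ∑ i ∈ S, (|v i| + |(w - v) i|) := by
          refine Finset.sum_le_sum fun i _ => ?_
          have := abs_add_le (v i) (w i - v i)
          simpa using this
      _ = ∑ i ∈ S, |v i| + ∑ i ∈ S, |(w - v) i| := Finset.sum_add_distrib
      _ ≤ _ := add_le_add (sum_abs_le_topk v S)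
          (Finset.sum_le_univ_sum_of_nonneg fun i => abs_nonneg _)

theorem continuous_topk {N k : ℕ} (hkN : k ≤ N) : Continuous (topk (N := N) k) := by
  refine continuous_iff_continuousAt.2 fun w => ?_
  have h0 : Tendsto (fun v : Fin N → ℝ => ell1 (v - w)) (𝓝 w) (𝓝 0) := by
    have : Continuous fun v : Fin N → ℝ => ell1 (v - w) :=
      continuous_ell1.comp (continuous_id.sub continuous_const)
    simpa [ell1] using this.tendsto w
  refine tendsto_iff_norm_sub_tendsto_zero.2 (squeeze_zero (fun _ => norm_nonneg _) ?_ h0)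
  intro v
  have h1 := topk_le_add_ell1_sub hkN v w
  have h2 := topk_le_add_ell1_sub hkN w v
  have h3 : ell1 (w - v) = ell1 (v - w) := by simp only [ell1, Pi.sub_apply, abs_sub_comm]
  rw [Real.norm_eq_abs, abs_le]
  constructor <;> linarith

theorem IsSubgradTopk.abs_apply_le_one {N k : ℕ} (hkN : k ≤ N) {w s : Fin N → ℝ}
    (h : IsSubgradTopk k w s) (i : Fin N) : |s i| ≤ 1 := by
  have key (a : ℝ) : s i * a ≤ |a| := by
    have h1 := h (w + Pi.single i a)
    have h2 := topk_le_add_ell1_sub hkN (w + Pi.single i a) w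
    have h3 : ell1 (Pi.single i a : Fin N → ℝ) = |a| := by
      rw [ell1, Finset.sum_eq_single i] <;> simp +contextual
    rw [add_sub_cancel_left, dotProduct_single] at h1
    rw [add_sub_cancel_left, h3] at h2
    linarith
  have h1 := key 1
  have h2 := key (-1)
  rw [abs_neg, abs_one] at h2
  rw [abs_one] at h1
  exact abs_le.2 ⟨by linarith, by linarith⟩

theorem isSubgradTopk_of_tendsto {N k : ℕ} (hkN : k ≤ N) {w s : ℕ → Fin N → ℝ}
    {wbar sbar : Fin N → ℝ} (hw : Tendsto w atTop (𝓝 wbar)) (hs : Tendsto s atTop (𝓝 sbar))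
    (h : ∀ n, IsSubgradTopk k (w n) (s n)) : IsSubgradTopk k wbar sbar := by
  intro v
  have hc : Continuous fun p : (Fin N → ℝ) × (Fin N → ℝ) => topk k p.1 + p.2 ⬝ᵥ (v - p.1) :=
    ((continuous_topk hkN).comp continuous_fst).add
      (continuous_snd.dotProduct (continuous_const.sub continuous_fst))
  exact le_of_tendsto ((hc.tendsto (wbar, sbar)).comp (hw.prodMk_nhds hs))
    (Eventually.of_forall fun n => h n v)

theorem isCompact_Feas (N : ℕ) (α : ℝ) : IsCompact (Feas N α) := by
  refine (isCompact_univ_pi fun _ : Fin N => isCompact_Icc (a := -α) (b := α)).of_isClosed_subset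
    ?_ fun w hw i _ => abs_le.1 (hw.2 i)
  refine IsClosed.and ?_ ?_
  · exact isClosed_eq (by fun_prop) continuous_const
  · simp only [Set.ofPred_forall]
    exact isClosed_iInter fun i => isClosed_le (by fun_prop) continuous_const

theorem add_smul_sub_mem_Feas {N : ℕ} {α : ℝ} {w v : Fin N → ℝ} (hw : w ∈ Feas N α)
    (hv : v ∈ Feas N α) {t : ℝ} (h0 : 0 ≤ t) (h1 : t ≤ 1) : w + t • (v - w) ∈ Feas N α := by
  refine ⟨?_, fun i => ?_⟩
  · simp [Finset.sum_add_distrib, ← Finset.mul_sum, hw.1, hv.1]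
  · have h : (w + t • (v - w)) i = (1 - t) * w i + t * v i := by
      simp only [Pi.add_apply, Pi.smul_apply, Pi.sub_apply, smul_eq_mul]; ring
    rw [h]
    have hwi := abs_le.1 (hw.2 i)
    have hvi := abs_le.1 (hv.2 i)
    exact abs_le.2 ⟨by nlinarith, by nlinarith⟩

/-- A uniform quadratic upper bound for `ftot` along segments of the feasible set. -/
theorem exists_ftot_add_smul_le {N T : ℕ} (l1 l2 l3 l4 α : ℝ) (μ : Fin N → ℝ)
    (r : Fin T → Fin N → ℝ) :
    ∃ L : ℝ, 0 < L ∧ ∀ w ∈ Feas N α, ∀ v ∈ Feas N α, ∀ t ∈ Set.Icc (0 : ℝ) 1,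
      ftot l1 l2 l3 l4 μ r (w + t • (v - w)) ≤ ftot l1 l2 l3 l4 μ r w
        + t * ((v - w) ⬝ᵥ gradf l1 l2 l3 l4 μ r w) + t ^ 2 * L := by
  have hc : Continuous fun p : (Fin N → ℝ) × (Fin N → ℝ) × ℝ =>
      l2 * ((p.2.1 - p.1) ⬝ᵥ (covar r).mulVec (p.2.1 - p.1))
        + fncvxRem l3 l4 r p.1 (p.2.1 - p.1) p.2.2 := by
    simp only [fncvxRem, dotProduct]
    fun_prop
  obtain ⟨L, hL⟩ := ((isCompact_Feas N α).prod
    ((isCompact_Feas N α).prod (isCompact_Icc (a := (0 : ℝ)) (b := 1)))).bddAbove_image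
      hc.continuousOn
  refine ⟨max L 1, by positivity, fun w hw v hv t ht => ?_⟩
  rw [ftot_add_smul]
  have h1 := hL (Set.mem_image_of_mem _ (Set.mk_mem_prod hw (Set.mk_mem_prod hv ht)))
  have h2 := mul_le_mul_of_nonneg_left (h1.trans (le_max_left L 1)) (sq_nonneg t)
  simp only at h2
  linarith

theorem dotProduct_mulVec_comm_of_isSymm {n : Type*} [Fintype n]
    {A : Matrix n n ℝ} (hA : Aᵀ = A) (x y : n → ℝ) :
    x ⬝ᵥ A.mulVec y = y ⬝ᵥ A.mulVec x := by
  rw [dotProduct_mulVec, dotProduct_comm, ← mulVec_transpose, hA]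

theorem nonneg_of_forall_add_mul_nonneg {a b : ℝ}
    (h : ∀ t : ℝ, 0 < t → t ≤ 1 → 0 ≤ t * a + t ^ 2 * b) : 0 ≤ a := by
  by_contra! ha
  have hb : 0 < |b| + |a| + 1 := by positivity
  set t : ℝ := |a| / (|b| + |a| + 1) with ht
  have hapos : 0 < |a| := abs_pos.2 ha.ne
  have ht0 : 0 < t := by positivity
  have ht1 : t ≤ 1 := (div_le_one hb).2 (by linarith [abs_nonneg b])
  have hta : t * (|b| + |a| + 1) = |a| := div_mul_cancel₀ _ hb.ne'
  have h1 := h t ht0 ht1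
  have h2 : 0 ≤ a + t * b := by
    by_contra! hneg
    nlinarith
  rw [abs_of_neg ha] at hta hapos
  nlinarith [le_abs_self b, mul_pos ht0 hapos]

/-- First-order optimality of a minimizer of the SCA subproblem. -/
theorem Fsca_variational_inequality {N T : ℕ} {l1 l2 l3 l4 ρ τw α : ℝ} (hρ : 0 ≤ ρ)
    {μ : Fin N → ℝ} {r : Fin T → Fin N → ℝ} {wj sj x : Fin N → ℝ}
    {H : Matrix (Fin N) (Fin N) ℝ} (hH : Hᵀ = H) (hx : x ∈ Feas N α)
    (hmin : ∀ v ∈ Feas N α,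
      Fsca l1 l2 l3 l4 ρ τw μ r wj sj H x ≤ Fsca l1 l2 l3 l4 ρ τw μ r wj sj H v)
    {v : Fin N → ℝ} (hv : v ∈ Feas N α) :
    0 ≤ (v - x) ⬝ᵥ (((-l1) • μ + (2 * l2) • (covar r).mulVec x) + gradfncvx l3 l4 r wj
        + H.mulVec (x - wj) + τw • (x - wj) - ρ • sj) + ρ * (ell1 v - ell1 x) := by
  refine nonneg_of_forall_add_mul_nonneg (b := l2 * ((v - x) ⬝ᵥ (covar r).mulVec (v - x))
    + 1 / 2 * ((v - x) ⬝ᵥ H.mulVec (v - x)) + τw / 2 * ((v - x) ⬝ᵥ (v - x))) fun t h0 h1 => ?_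
  have h2 := hmin _ (add_smul_sub_mem_Feas hx hv h0.le h1)
  have h3 := mul_le_mul_of_nonneg_left (ell1_add_smul_sub_le x v h0.le h1) hρ
  have hsq (y : Fin N → ℝ) : ∑ i, (y i - wj i) ^ 2 = (y - wj) ⬝ᵥ (y - wj) := by
    simp only [dotProduct, Pi.sub_apply, sq]
  generalize hd : v - x = d at *
  generalize he : x - wj = e at *
  have h4 : x + t • d - wj = e + t • d := by rw [← he]; abel
  simp only [Fsca, fcvx_add_smul, hsq, h4, he, mulVec_add, mulVec_smul, dotProduct_add,
    dotProduct_smul, add_dotProduct, smul_dotProduct, smul_eq_mul, dotProduct_sub] at h2 ⊢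
  rw [dotProduct_mulVec_comm_of_isSymm hH e d, dotProduct_comm e d,
    dotProduct_comm (gradfncvx l3 l4 r wj) d, dotProduct_comm sj d] at h2
  linarith

/-- The directional-derivative bound `Δ ≤ -τ ‖d‖²` for the SCA search direction. -/
theorem Fsca_descent_direction {N T : ℕ} {l1 l2 l3 l4 ρ τw α : ℝ} (hl2 : 0 ≤ l2) (hρ : 0 ≤ ρ)
    {μ : Fin N → ℝ} {r : Fin T → Fin N → ℝ} {wj sj x : Fin N → ℝ}
    {H : Matrix (Fin N) (Fin N) ℝ} (hH : H.PosSemidef) (hwj : wj ∈ Feas N α) (hx : x ∈ Feas N α)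
    (hmin : ∀ v ∈ Feas N α,
      Fsca l1 l2 l3 l4 ρ τw μ r wj sj H x ≤ Fsca l1 l2 l3 l4 ρ τw μ r wj sj H v) :
    (x - wj) ⬝ᵥ (gradf l1 l2 l3 l4 μ r wj - ρ • sj) + ρ * (ell1 x - ell1 wj)
      ≤ -(τw * ((x - wj) ⬝ᵥ (x - wj))) := by
  have hHt : Hᵀ = H := (conjTranspose_eq_transpose_of_trivial H).symm.trans hH.isHermitian.eq
  have h1 := Fsca_variational_inequality hρ hHt hx hmin hwj
  have h2 : 0 ≤ (x - wj) ⬝ᵥ H.mulVec (x - wj) := by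
    simpa using hH.dotProduct_mulVec_nonneg (x - wj)
  have h3 := mul_nonneg hl2 (dotProduct_covar_mulVec_self_nonneg r (x - wj))
  have h4 : x = wj + (x - wj) := by abel
  generalize hd : x - wj = d at *
  have h5 : wj - x = -d := by rw [← hd]; abel
  have h6 : (covar r).mulVec x = (covar r).mulVec wj + (covar r).mulVec d := by
    conv_lhs => rw [h4]
    rw [mulVec_add]
  simp only [h5, h6, gradf, neg_dotProduct, dotProduct_add, dotProduct_smul, smul_eq_mul,
    dotProduct_sub] at h1 ⊢
  linarith

/-- Sufficient decrease of the penalized objective. -/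
theorem fpen_add_smul_le {N T : ℕ} {l1 l2 l3 l4 ρ c β : ℝ} {k : ℕ} (hρ : 0 ≤ ρ) (hβ0 : 0 ≤ β)
    (hβ1 : β ≤ 1) {μ : Fin N → ℝ} {r : Fin T → Fin N → ℝ} {wj sj x : Fin N → ℝ} {m : ℕ}
    (hs : IsSubgradTopk k wj sj) (hA : Armijo l1 l2 l3 l4 ρ c β μ r wj sj x m) :
    fpen l1 l2 l3 l4 ρ k μ r (wj + β ^ m • (x - wj)) ≤ fpen l1 l2 l3 l4 ρ k μ r wj
      + c * β ^ m * ((x - wj) ⬝ᵥ (gradf l1 l2 l3 l4 μ r wj - ρ • sj)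
            + ρ * (ell1 x - ell1 wj)) := by
  have h1 := mul_le_mul_of_nonneg_left
    (ell1_add_smul_sub_le wj x (pow_nonneg hβ0 m) (pow_le_one₀ hβ0 hβ1)) hρ
  have h2 := mul_le_mul_of_nonneg_left (hs (wj + β ^ m • (x - wj))) hρ
  rw [add_sub_cancel_left, dotProduct_smul, smul_eq_mul, dotProduct_comm] at h2
  unfold Armijo at hA
  unfold fpen
  linarith

/-- Lower bound on the accepted step size in terms of the search direction. -/
theorem sq_norm_direction_le_stepsize {N T : ℕ} {l1 l2 l3 l4 ρ c β τ L : ℝ} (hc : c < 1)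
    (hβ0 : 0 < β) (hβ1 : β < 1) {μ : Fin N → ℝ} {r : Fin T → Fin N → ℝ}
    {wj sj x : Fin N → ℝ} {m : ℕ}
    (hL : ∀ t ∈ Set.Icc (0 : ℝ) 1, ftot l1 l2 l3 l4 μ r (wj + t • (x - wj))
      ≤ ftot l1 l2 l3 l4 μ r wj + t * ((x - wj) ⬝ᵥ gradf l1 l2 l3 l4 μ r wj) + t ^ 2 * L)
    (hΔ : (x - wj) ⬝ᵥ (gradf l1 l2 l3 l4 μ r wj - ρ • sj) + ρ * (ell1 x - ell1 wj)
      ≤ -(τ * ((x - wj) ⬝ᵥ (x - wj))))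
    (hA : ¬ Armijo l1 l2 l3 l4 ρ c β μ r wj sj x m) :
    (1 - c) * τ * ((x - wj) ⬝ᵥ (x - wj)) ≤ L * β ^ m := by
  have ht : 0 < β ^ m := pow_pos hβ0 m
  have h1 := hL (β ^ m) ⟨ht.le, pow_le_one₀ hβ0.le hβ1.le⟩
  unfold Armijo at hA
  rw [not_le] at hA
  rw [dotProduct_sub, dotProduct_smul, smul_eq_mul] at hA hΔ
  generalize hD : (x - wj) ⬝ᵥ gradf l1 l2 l3 l4 μ r wj - ρ * ((x - wj) ⬝ᵥ sj)
    + ρ * (ell1 x - ell1 wj) = D at *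
  have h2 : 0 < β ^ m * ((1 - c) * D + β ^ m * L) := by
    rw [← hD] at hA ⊢
    linarith
  have h3 := pos_of_mul_pos_right h2 ht.le
  nlinarith [mul_le_mul_of_nonneg_left hΔ (sub_nonneg.2 hc.le)]

/-- Matrices bounded in Frobenius norm map null sequences to null sequences. -/
theorem tendsto_mulVec_zero_of_sqrt_sum_sq_le {N : ℕ} {B : ℝ} {H : ℕ → Matrix (Fin N) (Fin N) ℝ}
    {d : ℕ → Fin N → ℝ} (hHB : ∀ j, Real.sqrt (∑ i, ∑ i', (H j i i') ^ 2) ≤ B)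
    (hd : Tendsto d atTop (𝓝 0)) : Tendsto (fun j => (H j).mulVec (d j)) atTop (𝓝 0) := by
  have hdi (i : Fin N) : Tendsto (fun j => d j i) atTop (𝓝 0) := tendsto_pi_nhds.1 hd i
  have hHij (j : ℕ) (i i' : Fin N) : |H j i i'| ≤ B :=
    (Real.abs_le_sqrt ((Finset.single_le_sum (f := fun i' => (H j i i') ^ 2)
        (fun _ _ => sq_nonneg _) (Finset.mem_univ i')).trans
      (Finset.single_le_sum (f := fun i => ∑ i', (H j i i') ^ 2)
        (fun _ _ => Finset.sum_nonneg fun _ _ => sq_nonneg _) (Finset.mem_univ i)))).trans (hHB j)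
  refine tendsto_pi_nhds.2 fun i => ?_
  have : Tendsto (fun j => ∑ i', H j i i' * d j i') atTop
      (𝓝 (∑ _i' : Fin N, (0 : ℝ))) := by
    refine tendsto_finsetSum _ fun i' _ => squeeze_zero_norm (a := fun j =>
      B * ‖d j i'‖) (fun j => ?_) (by simpa using (hdi i').norm.const_mul B)
    rw [norm_mul]
    exact mul_le_mul_of_nonneg_right (hHij j i i') (norm_nonneg _)
  simpa [mulVec, dotProduct] using this

/-- The SCA search directions tend to zero. -/
theorem sca_direction_tendsto_zero {N T : ℕ} {l1 l2 l3 l4 α ρ τw c β : ℝ}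
    (hl2 : 0 ≤ l2) (hρ : 0 ≤ ρ) (hτw : 0 < τw) (hc : 0 < c ∧ c < 1) (hβ : 0 < β ∧ β < 1)
    {k : ℕ} (hkN : k ≤ N) {μ : Fin N → ℝ} {r : Fin T → Fin N → ℝ}
    {w s what : ℕ → Fin N → ℝ} {H : ℕ → Matrix (Fin N) (Fin N) ℝ} {m : ℕ → ℕ}
    (hw : ∀ j, w j ∈ Feas N α)
    (hs : ∀ j, IsSubgradTopk k (w j) (s j))
    (hH : ∀ j, (H j).PosSemidef)
    (hwhat : ∀ j, what j ∈ Feas N α)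
    (hminF : ∀ j, ∀ v ∈ Feas N α,
      Fsca l1 l2 l3 l4 ρ τw μ r (w j) (s j) (H j) (what j)
        ≤ Fsca l1 l2 l3 l4 ρ τw μ r (w j) (s j) (H j) v)
    (hm : ∀ j, Armijo l1 l2 l3 l4 ρ c β μ r (w j) (s j) (what j) (m j) ∧
      ∀ m' : ℕ, Armijo l1 l2 l3 l4 ρ c β μ r (w j) (s j) (what j) m' → m j ≤ m')
    (hupd : ∀ j, w (j + 1) = w j + β ^ (m j) • (what j - w j)) :
    Tendsto (fun j => what j - w j) atTop (𝓝 0) := by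
  have hβp (j : ℕ) : 0 < β ^ m j := pow_pos hβ.1 _
  have hΔ (j : ℕ) := Fsca_descent_direction hl2 hρ (hH j) (hw j) (hwhat j) (hminF j)
  have hd0 (j : ℕ) : 0 ≤ (what j - w j) ⬝ᵥ (what j - w j) := by
    simpa using dotProduct_star_self_nonneg (what j - w j)
  have hdec (j : ℕ) : c * τw * (β ^ m j * ((what j - w j) ⬝ᵥ (what j - w j)))
      ≤ fpen l1 l2 l3 l4 ρ k μ r (w j) - fpen l1 l2 l3 l4 ρ k μ r (w (j + 1)) := by
    have h1 := fpen_add_smul_le hρ hβ.1.le hβ.2.le (hs j) (hm j).1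
    rw [← hupd j] at h1
    have h2 := mul_le_mul_of_nonneg_left (hΔ j) (mul_pos hc.1 (hβp j)).le
    linarith
  have hfpen : Continuous (fpen l1 l2 l3 l4 ρ k μ r) :=
    (continuous_ftot l1 l2 l3 l4 μ r).add
      (continuous_const.mul (continuous_ell1.sub (continuous_topk hkN)))
  have hstep : Tendsto (fun j => β ^ m j * ((what j - w j) ⬝ᵥ (what j - w j))) atTop (𝓝 0) := by
    have hanti : Antitone fun j => fpen l1 l2 l3 l4 ρ k μ r (w j) :=
      antitone_nat_of_succ_le fun j => by
        have := hdec j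
        have := mul_nonneg (mul_pos hc.1 hτw).le (mul_nonneg (hβp j).le (hd0 j))
        linarith
    obtain ⟨b, hb⟩ := (isCompact_Feas N α).bddBelow_image hfpen.continuousOn
    have hlim := tendsto_atTop_ciInf hanti
      ⟨b, by rintro _ ⟨j, rfl⟩; exact hb (Set.mem_image_of_mem _ (hw j))⟩
    have hdiff := hlim.sub (hlim.comp (tendsto_add_atTop_nat 1))
    rw [sub_self] at hdiff
    have hz := squeeze_zero (fun j => mul_nonneg (mul_pos hc.1 hτw).le
      (mul_nonneg (hβp j).le (hd0 j))) hdec hdiff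
    simpa [← mul_assoc, hc.1.ne', hτw.ne'] using hz.const_mul (c * τw)⁻¹
  obtain ⟨L, hL0, hL⟩ := exists_ftot_add_smul_le l1 l2 l3 l4 α μ r
  have hsq : Continuous fun p : (Fin N → ℝ) × (Fin N → ℝ) => (p.1 - p.2) ⬝ᵥ (p.1 - p.2) := by
    unfold dotProduct
    fun_prop
  obtain ⟨D, hD⟩ := ((isCompact_Feas N α).prod (isCompact_Feas N α)).bddAbove_image
    hsq.continuousOn
  have hDj (j : ℕ) : (what j - w j) ⬝ᵥ (what j - w j) ≤ D :=
    hD (Set.mem_image_of_mem _ (Set.mk_mem_prod (hwhat j) (hw j)))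
  have hcτ : 0 < (1 - c) * τw := mul_pos (sub_pos.2 hc.2) hτw
  have hbound (j : ℕ) : ((what j - w j) ⬝ᵥ (what j - w j)) ^ 2
      ≤ (D + L / β / ((1 - c) * τw)) * (β ^ m j * ((what j - w j) ⬝ᵥ (what j - w j))) := by
    have hK : 0 ≤ L / β / ((1 - c) * τw) := by have := hβ.1; positivity
    have hle : (what j - w j) ⬝ᵥ (what j - w j) ≤ (D + L / β / ((1 - c) * τw)) * β ^ m j := by
      cases hmj : m j with
      | zero => rw [pow_zero, mul_one]; linarith [hDj j]
      | succ i =>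
        have hA : ¬ Armijo l1 l2 l3 l4 ρ c β μ r (w j) (s j) (what j) i := fun h => by
          have := (hm j).2 i h
          omega
        have h1 := sq_norm_direction_le_stepsize hc.2 hβ.1 hβ.2
          (hL _ (hw j) _ (hwhat j)) (hΔ j) hA
        have h2 : L / β / ((1 - c) * τw) * β ^ (i + 1) = L * β ^ i / ((1 - c) * τw) := by
          have := hβ.1.ne'
          rw [pow_succ]
          field_simp
        rw [add_mul, h2]
        have h3 : (what j - w j) ⬝ᵥ (what j - w j) ≤ L * β ^ i / ((1 - c) * τw) := by
          rw [le_div_iff₀ hcτ]; linarith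
        have h4 := mul_nonneg ((hd0 j).trans (hDj j)) (pow_pos hβ.1 (i + 1)).le
        linarith
    rw [sq, ← mul_assoc]
    exact mul_le_mul_of_nonneg_right hle (hd0 j)
  have hdd : Tendsto (fun j => (what j - w j) ⬝ᵥ (what j - w j)) atTop (𝓝 0) := by
    have h1 := squeeze_zero (fun j => sq_nonneg _) hbound
      (by simpa using hstep.const_mul (D + L / β / ((1 - c) * τw)))
    have h2 := h1.sqrt
    simpa only [Real.sqrt_sq (hd0 _), Real.sqrt_zero] using h2
  have hdi (i : Fin N) : Tendsto (fun j => (what j - w j) i) atTop (𝓝 0) := by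
    refine squeeze_zero_norm (fun j => ?_) (by simpa only [Real.sqrt_zero] using hdd.sqrt)
    rw [Real.norm_eq_abs]
    refine Real.abs_le_sqrt ?_
    rw [sq]
    exact Finset.single_le_sum (f := fun i => (what j - w j) i * (what j - w j) i)
      (fun i _ => mul_self_nonneg _) (Finset.mem_univ i)
  exact tendsto_pi_nhds.2 hdi

/-- convergence of SCA with backtracking line search. For a sequence
generated by SCA (subproblem minimizers `ŵʲ⁺¹`, uniformly bounded PSD matrices `Hʲ`,
smallest Armijo exponents `mⱼ`, stepsizes `γⱼ = β^{mⱼ}`), every limit point `w̄` of `{wʲ}`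
is a stationary point of the penalized problem: there is a subgradient `s̄` of the
largest-`k` norm at `w̄` with
`(w − w̄)ᵀ(∇f(w̄) − ρ s̄) + ρ(‖w‖₁ − ‖w̄‖₁) ≥ 0` for all `w ∈ C`. -/
theorem sca_limit_points_stationary {N T : ℕ} (hN : 0 < N) (hT : 1 ≤ T)
    (l1 l2 l3 l4 α ρ τw c β B : ℝ)
    (hl1 : 0 < l1) (hl2 : 0 < l2) (hl3 : 0 < l3) (hl4 : 0 < l4)
    (hα : 0 < α) (hρ : 0 < ρ) (hτw : 0 < τw)
    (hc : 0 < c ∧ c < 1) (hβ : 0 < β ∧ β < 1)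
    (k : ℕ) (hk1 : 1 ≤ k) (hkN : k ≤ N)
    (μ : Fin N → ℝ) (r : Fin T → Fin N → ℝ)
    (w s what : ℕ → Fin N → ℝ) (H : ℕ → Matrix (Fin N) (Fin N) ℝ) (m : ℕ → ℕ)
    (hw : ∀ j, w j ∈ Feas N α)
    (hs : ∀ j, IsSubgradTopk k (w j) (s j))
    (hH : ∀ j, (H j).PosSemidef)
    (hHB : ∀ j, Real.sqrt (∑ i, ∑ i', (H j i i') ^ 2) ≤ B)
    (hwhat : ∀ j, what j ∈ Feas N α)
    (hminF : ∀ j, ∀ v ∈ Feas N α,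
      Fsca l1 l2 l3 l4 ρ τw μ r (w j) (s j) (H j) (what j)
        ≤ Fsca l1 l2 l3 l4 ρ τw μ r (w j) (s j) (H j) v)
    (hm : ∀ j, Armijo l1 l2 l3 l4 ρ c β μ r (w j) (s j) (what j) (m j) ∧
      ∀ m' : ℕ, Armijo l1 l2 l3 l4 ρ c β μ r (w j) (s j) (what j) m' → m j ≤ m')
    (hupd : ∀ j, w (j + 1) = w j + β ^ (m j) • (what j - w j)) :
    ∀ wbar : Fin N → ℝ,
      (∃ φ : ℕ → ℕ, StrictMono φ ∧ Tendsto (fun n => w (φ n)) atTop (𝓝 wbar)) →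
        ∃ sbar : Fin N → ℝ, IsSubgradTopk k wbar sbar ∧
          ∀ v ∈ Feas N α,
            0 ≤ (v - wbar) ⬝ᵥ (gradf l1 l2 l3 l4 μ r wbar - ρ • sbar)
                + ρ * (ell1 v - ell1 wbar) := by
  have hd := sca_direction_tendsto_zero hl2.le hρ.le hτw hc hβ hkN hw hs hH hwhat hminF hm hupd
  have hHd := tendsto_mulVec_zero_of_sqrt_sum_sq_le hHB hd
  rintro wbar ⟨φ, hφ, hφw⟩
  obtain ⟨sbar, -, ψ, hψ, hψs⟩ :=
    (isCompact_univ_pi fun _ : Fin N => isCompact_Icc (a := (-1 : ℝ)) (b := 1)).tendsto_subseq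
      (x := fun n => s (φ n)) fun n i _ => abs_le.1 ((hs (φ n)).abs_apply_le_one hkN i)
  have hθ : Tendsto (φ ∘ ψ) atTop atTop := (hφ.comp hψ).tendsto_atTop
  have hwθ : Tendsto (fun n => w (φ (ψ n))) atTop (𝓝 wbar) := hφw.comp hψ.tendsto_atTop
  have hdθ : Tendsto (fun n => what (φ (ψ n)) - w (φ (ψ n))) atTop (𝓝 0) := hd.comp hθ
  have hxθ : Tendsto (fun n => what (φ (ψ n))) atTop (𝓝 wbar) := by
    simpa using hwθ.add hdθ
  refine ⟨sbar, isSubgradTopk_of_tendsto hkN hwθ hψs fun n => hs _, fun v hv => ?_⟩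
  have hHt (j : ℕ) : (H j)ᵀ = H j :=
    (conjTranspose_eq_transpose_of_trivial (H j)).symm.trans (hH j).isHermitian.eq
  have hgrad : Tendsto (fun n => ((-l1) • μ + (2 * l2) • (covar r).mulVec (what (φ (ψ n))))
        + gradfncvx l3 l4 r (w (φ (ψ n)))
        + (H (φ (ψ n))).mulVec (what (φ (ψ n)) - w (φ (ψ n)))
        + τw • (what (φ (ψ n)) - w (φ (ψ n))) - ρ • s (φ (ψ n))) atTop
      (𝓝 (gradf l1 l2 l3 l4 μ r wbar - ρ • sbar)) := by
    have hcov : Continuous fun x : Fin N → ℝ => (covar r).mulVec x :=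
      continuous_const.matrix_mulVec continuous_id
    have h1 := (tendsto_const_nhds (x := (-l1) • μ)).add
      (((hcov.tendsto wbar).comp hxθ).const_smul (2 * l2))
    have h2 := (((h1.add (((continuous_gradfncvx l3 l4 r).tendsto wbar).comp hwθ)).add
      (hHd.comp hθ)).add (hdθ.const_smul τw)).sub (hψs.const_smul ρ)
    simpa [gradf] using h2
  have hpair : Continuous fun p : (Fin N → ℝ) × (Fin N → ℝ) =>
      (v - p.1) ⬝ᵥ p.2 + ρ * (ell1 v - ell1 p.1) :=
    ((continuous_const.sub continuous_fst).dotProduct continuous_snd).add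
      (continuous_const.mul (continuous_const.sub (continuous_ell1.comp continuous_fst)))
  exact ge_of_tendsto ((hpair.tendsto (wbar, _)).comp (hxθ.prodMk_nhds hgrad))
    (Eventually.of_forall fun n => Fsca_variational_inequality hρ.le (hHt _) (hwhat _)
      (hminF _) hv)
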